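/- There exists a linear automorphism Φ of H with Φ(δ_∅) = δ_∅ such that Φ(δ_T × v) = −Φ(v) × δ_T for every rooted tree T and every v ∈ H. In particular, the insertion representation of n_T on H (where T acts by v ↦ δ_T × v) is isomorphic to the top-insertion representation of n_T on H (where T acts by v ↦ −v × δ_T). -/

import Mathlib

open scoped Classical

/-- Concrete (labeled) rooted trees: a root with a list of subtrees. -/
inductive RTree : Type
  | node : List RTree → RTree

/-- Shapes of admissible cuts: at each tree, either the full cut
(everything, including the root, goes to the pruned part `P`), or a choice of
an admissible cut of each child subtree.  A `full` occurring strictly inside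
corresponds to cutting the edge above that vertex. -/
inductive CutShape : Type
  | full
  | branch : List CutShape → CutShape

namespace CK

/-- Number of vertices of a forest. -/
def sizeL : List RTree → ℕ
  | [] => 0
  | .node l :: ts => 1 + sizeL l + sizeL ts

/-- All admissible cuts of a forest (a choice of admissible cut of each tree). -/
def cutsF : List RTree → List (List CutShape)
  | [] => [[]]
  | .node l :: ts =>
      (CutShape.full :: (cutsF l).map CutShape.branch).flatMap
        fun c => (cutsF ts).map (c :: ·)

/-- The root part `R_C(F)` of a cut. -/
def Rcut : List RTree → List CutShape → List RTree
  | [], _ => []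
  | _ :: _, [] => []
  | .node _ :: ts, .full :: cs => Rcut ts cs
  | .node l :: ts, .branch ds :: cs => RTree.node (Rcut l ds) :: Rcut ts cs

/-- The pruned part `P_C(F)` of a cut. -/
def Pcut : List RTree → List CutShape → List RTree
  | [], _ => []
  | _ :: _, [] => []
  | .node l :: ts, .full :: cs => RTree.node l :: Pcut ts cs
  | .node l :: ts, .branch ds :: cs => Pcut l ds ++ Pcut ts cs

/-- Number of `full`s occurring in a cut. -/
def fullsL : List CutShape → ℕ
  | [] => 0
  | .full :: cs => 1 + fullsL cs
  | .branch ds :: cs => fullsL ds + fullsL cs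

/-- A list of concrete forests containing (representatives of) every forest
with at most `n` vertices. -/
def forestsUpTo : ℕ → List (List RTree)
  | 0 => [[]]
  | n+1 => [] :: (forestsUpTo n).flatMap fun l => (forestsUpTo n).map fun F => RTree.node l :: F

/-- Isomorphism of rooted trees (non-planar): a root-preserving bijection, i.e.
the lists of subtrees agree up to permutation and isomorphism. -/
inductive Iso : RTree → RTree → Prop
  | node {l₁ l l₂ : List RTree} : List.Forall₂ Iso l₁ l → l.Perm l₂ → Iso (.node l₁) (.node l₂)

/-- Isomorphism classes of rooted trees. -/
abbrev TreeClass : Type := Quot Iso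

/-- Isomorphism classes of rooted forests = multisets of tree classes.
The empty forest is `0`. -/
abbrev ForestClass : Type := Multiset TreeClass

/-- Isomorphism class of a tree. -/
def clT (t : RTree) : TreeClass := Quot.mk _ t

/-- Isomorphism class of a forest. -/
def clF (F : List RTree) : ForestClass := (F.map clT : List TreeClass)

/-- A concrete representative of a forest class. -/
noncomputable def repF (M : ForestClass) : List RTree := M.toList.map Quot.out

/-- A concrete representative of a tree class. -/
noncomputable def repT (T : TreeClass) : RTree := T.out

/-- Number of vertices of a forest class. -/
noncomputable def sizeC (M : ForestClass) : ℕ := sizeL (repF M)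

/-- Number of vertices of a tree class. -/
noncomputable def sizeT (T : TreeClass) : ℕ := sizeL [repT T]

/-- The Hall algebra `H`: finitely supported ℚ-valued functions on
isomorphism classes of rooted forests, with basis the delta functions. -/
abbrev H : Type := ForestClass →₀ ℚ

/-- The basis element `δ_A` of `H`. -/
noncomputable def delta (A : ForestClass) : H := Finsupp.single A 1

/-- `n(A,B;M)`: the number of admissible cuts `C` of `M` with
`P_C(M) ≅ A` and `R_C(M) ≅ B`. -/
noncomputable def nCuts (A B M : ForestClass) : ℕ :=
  (cutsF (repF M)).countP fun c =>
    decide (clF (Pcut (repF M) c) = A ∧ clF (Rcut (repF M) c) = B)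

/-- A finite set of forest classes containing all classes with at most `n`
vertices. -/
noncomputable def forestCand (n : ℕ) : Finset ForestClass :=
  ((forestsUpTo n).map clF).toFinset

/-- A finite set of tree classes containing all classes with at most `n+1`
vertices. -/
noncomputable def treeCand (n : ℕ) : Finset TreeClass :=
  ((forestsUpTo n).map fun F => clT (RTree.node F)).toFinset

/-- The Hall product on basis elements: `δ_A × δ_B = Σ_M n(A,B;M)·δ_M`
(every `M` with `n(A,B;M) ≠ 0` has exactly `sizeC A + sizeC B` vertices). -/
noncomputable def mulBasis (A B : ForestClass) : H :=
  ∑ M ∈ forestCand (sizeC A + sizeC B), (nCuts A B M : ℚ) • delta M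

/-- The Hall product on `H`, extended bilinearly from basis elements. -/
noncomputable def hmul (f g : H) : H :=
  f.sum fun A a => g.sum fun B b => (a * b) • mulBasis A B

/-- The Connes-Kreimer Lie algebra `n_T` (as a vector space): the span of
isomorphism classes of rooted trees. -/
abbrev nT : Type := TreeClass →₀ ℚ

/-- The basis element of `n_T` corresponding to a rooted tree `T`. -/
noncomputable def tau (T : TreeClass) : nT := Finsupp.single T 1

/-- `a(T₁,T₂;T)`: the number of edges `e` of `T` such that the single-edge cut
at `e` has pruned part `≅ T₁` and root part `≅ T₂`. -/
noncomputable def aCount (T₁ T₂ T : TreeClass) : ℕ :=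
  (cutsF [repT T]).countP fun c =>
    decide (fullsL c = 1 ∧ clF (Pcut [repT T] c) = ({T₁} : Multiset TreeClass)
      ∧ clF (Rcut [repT T] c) = ({T₂} : Multiset TreeClass))

/-- The grafting (pre-Lie) product on basis elements:
`T₁ * T₂ = Σ_T a(T₁,T₂;T)·T`. -/
noncomputable def graftBasis (T₁ T₂ : TreeClass) : nT :=
  ∑ T ∈ treeCand (sizeT T₁ + sizeT T₂), (aCount T₁ T₂ T : ℚ) • tau T

/-- The grafting (pre-Lie) product on `n_T`, extended bilinearly. -/
noncomputable def graft (x y : nT) : nT :=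
  x.sum fun T₁ a => y.sum fun T₂ b => (a * b) • graftBasis T₁ T₂

/-- The Connes-Kreimer bracket `[x,y] = x*y - y*x` on `n_T`. -/
noncomputable def ckBracket (x y : nT) : nT := graft x y - graft y x

/-- `Ẽ_A δ_B = Σ_C δ_{R_C(B)}`, the sum over admissible cuts `C` of `B` with
`P_C(B) ≅ A`. -/
noncomputable def elimBasis (A B : ForestClass) : H :=
  (((cutsF (repF B)).filter fun c => decide (clF (Pcut (repF B) c) = A)).map
    fun c => delta (clF (Rcut (repF B) c))).sum

/-- The elimination operator `E_A` (here on `H ≅ H*`, identifying `φ_B` with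
`δ_B`). -/
noncomputable def elim (A : ForestClass) : H →ₗ[ℚ] H :=
  Finsupp.lsum ℚ fun B => LinearMap.toSpanSingleton ℚ H (elimBasis A B)

/-- `Ẽ^top_A δ_B = Σ_C δ_{P_C(B)}`, the sum over admissible cuts `C` of `B`
with `R_C(B) ≅ A`. -/
noncomputable def topElimBasis (A B : ForestClass) : H :=
  (((cutsF (repF B)).filter fun c => decide (clF (Rcut (repF B) c) = A)).map
    fun c => delta (clF (Pcut (repF B) c))).sum

/-- The top-elimination operator `E^top_A`. -/
noncomputable def topElim (A : ForestClass) : H →ₗ[ℚ] H :=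
  Finsupp.lsum ℚ fun B => LinearMap.toSpanSingleton ℚ H (topElimBasis A B)

/-- `H ⊗ H`, realized as finitely supported functions on pairs of classes. -/
abbrev H2 : Type := (ForestClass × ForestClass) →₀ ℚ

/-- `Δ(δ_M) = Σ δ_A ⊗ δ_B`, the sum over ordered pairs `(A,B)` of classes with
`A ⊔ B ≅ M`. -/
noncomputable def deltaBasis (M : ForestClass) : H2 :=
  ∑ A ∈ M.powerset.toFinset, Finsupp.single (A, M - A) 1

/-- The coproduct `Δ : H → H ⊗ H`. -/
noncomputable def coprod : H →ₗ[ℚ] H2 :=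
  Finsupp.lsum ℚ fun M => LinearMap.toSpanSingleton ℚ H2 (deltaBasis M)

/-! ### Summation over cuts -/

/-- Sum of `φ` over a multiset of pairs. -/
noncomputable def I (s : Multiset (ForestClass × ForestClass))
    (φ : ForestClass → ForestClass → ℚ) : ℚ :=
  (s.map fun p => φ p.1 p.2).sum

/-- The multiset of `(P,R)` over all cuts of a concrete forest. -/
noncomputable def dL (F : List RTree) : Multiset (ForestClass × ForestClass) :=
  (((cutsF F).map fun c => (clF (Pcut F c), clF (Rcut F c))) :
    List (ForestClass × ForestClass))

lemma I_comm (s t : Multiset (ForestClass × ForestClass))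
    (ψ : ForestClass → ForestClass → ForestClass → ForestClass → ℚ) :
    I s (fun P R => I t fun P' R' => ψ P R P' R')
      = I t (fun P' R' => I s fun P R => ψ P R P' R') := by
  unfold I
  exact Multiset.sum_map_sum_map s t

lemma I_add (s : Multiset (ForestClass × ForestClass))
    (φ ψ : ForestClass → ForestClass → ℚ) :
    I s (fun P R => φ P R + ψ P R) = I s φ + I s ψ := by
  unfold I
  exact Multiset.sum_map_add

lemma I_mul_left (s : Multiset (ForestClass × ForestClass)) (a : ℚ)
    (φ : ForestClass → ForestClass → ℚ) :
    I s (fun P R => a * φ P R) = a * I s φ := by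
  unfold I
  exact Multiset.sum_map_mul_left

lemma I_mul_right (s : Multiset (ForestClass × ForestClass)) (a : ℚ)
    (φ : ForestClass → ForestClass → ℚ) :
    I s (fun P R => φ P R * a) = I s φ * a := by
  unfold I
  exact Multiset.sum_map_mul_right

lemma I_sum {ι : Type*} (s : Multiset (ForestClass × ForestClass)) (u : Finset ι)
    (φ : ι → ForestClass → ForestClass → ℚ) :
    I s (fun P R => ∑ i ∈ u, φ i P R) = ∑ i ∈ u, I s (φ i) := by
  induction u using Finset.induction_on with
  | empty => simp [I]
  | insert a u ha ih => simp only [Finset.sum_insert ha, I_add, ih]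

lemma I_zero (s : Multiset (ForestClass × ForestClass)) :
    I s (fun _ _ => 0) = 0 := by
  simp [I]

lemma clF_nil : clF [] = 0 := rfl

lemma clF_cons (t : RTree) (F : List RTree) : clF (t :: F) = {clT t} + clF F := by
  simp [clF]

lemma clF_append (F G : List RTree) : clF (F ++ G) = clF F + clF G := by
  simp [clF]

lemma card_clF (F : List RTree) : (clF F).card = F.length := by
  simp [clF]

lemma clT_out (T : TreeClass) : clT T.out = T := Quot.out_eq T

lemma clF_repF (M : ForestClass) : clF (repF M) = M := by
  unfold clF repF
  rw [List.map_map]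
  have : (clT ∘ Quot.out : TreeClass → TreeClass) = id := by
    funext T; exact clT_out T
  rw [this, List.map_id, Multiset.coe_toList]

lemma rtree_size_induction {p : RTree → Prop}
    (h : ∀ l, (∀ t ∈ l, p t) → p (.node l)) (t : RTree) : p t := by
  have key : ∀ n (t : RTree), sizeOf t ≤ n → p t := by
    intro n
    induction n with
    | zero =>
      intro t ht
      cases t with
      | node l => simp at ht
    | succ n ih =>
      intro t ht
      cases t with
      | node l =>
        apply h
        intro s hs
        apply ih
        have := List.sizeOf_lt_of_mem hs
        simp at ht
        omega
  exact key _ t le_rfl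

lemma iso_refl (t : RTree) : Iso t t := by
  induction t using rtree_size_induction with
  | h l ih => exact Iso.node (List.forall₂_same.2 ih) (List.Perm.refl l)

lemma exists_of_clF_eq {F G : List RTree} (h : clF F = clF G) :
    ∃ G', List.Forall₂ (fun s t => clT s = clT t) F G' ∧ G'.Perm G := by
  have h1 : (F.map clT).Perm (G.map clT) := Multiset.coe_eq_coe.1 h
  have h2 : List.Forall₂ (fun x t => x = clT t) (G.map clT) G := by
    rw [List.forall₂_map_left_iff]
    exact List.forall₂_same.2 fun _ _ => rfl
  obtain ⟨G', h3, h4⟩ := List.perm_comp_forall₂ h1 h2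
  rw [List.forall₂_map_left_iff] at h3
  exact ⟨G', h3, h4⟩

lemma node_congr_one {a b : RTree} (h : clT a = clT b) (p s : List RTree) :
    clT (.node (p ++ a :: s)) = clT (.node (p ++ b :: s)) := by
  have hs : ∀ a b, Iso a b → clT (.node (p ++ a :: s)) = clT (.node (p ++ b :: s)) := by
    intro a b hab
    apply Quot.sound
    refine Iso.node (l := p ++ b :: s) ?_ (List.Perm.refl _)
    apply List.rel_append
    · exact List.forall₂_same.2 fun t _ => iso_refl t
    · exact List.Forall₂.cons hab (List.forall₂_same.2 fun t _ => iso_refl t)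
  exact congrArg (Quot.lift (fun a => clT (.node (p ++ a :: s))) hs) h

lemma node_congr_forall {F G : List RTree}
    (h : List.Forall₂ (fun s t => clT s = clT t) F G) :
    ∀ p, clT (.node (p ++ F)) = clT (.node (p ++ G)) := by
  induction h with
  | nil => intro p; rfl
  | @cons a b F G hab _ ih =>
    intro p
    rw [node_congr_one hab p F]
    have := ih (p ++ [b])
    simpa using this

lemma node_congr {F G : List RTree} (h : clF F = clF G) :
    clT (.node F) = clT (.node G) := by
  obtain ⟨G', h1, h2⟩ := exists_of_clF_eq h
  rw [show clT (.node F) = clT (.node G') from node_congr_forall h1 []]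
  exact Quot.sound (Iso.node (List.forall₂_same.2 fun t _ => iso_refl t) h2)

/-- Grafting all trees of a forest class to a new root. -/
noncomputable def Bp (F : ForestClass) : TreeClass := clT (.node (repF F))

lemma clT_node (l : List RTree) : clT (.node l) = Bp (clF l) :=
  node_congr (clF_repF _).symm

lemma I_dL_nil (φ) : I (dL []) φ = φ 0 0 := by
  simp [I, dL, cutsF, Pcut, Rcut, clF_nil]

lemma I_dL_cons (l ts : List RTree) (φ) :
    I (dL (.node l :: ts)) φ
      = I (dL ts) (fun P R => φ ({Bp (clF l)} + P) R)
        + I (dL l) (fun P R => I (dL ts) fun P' R' => φ (P + P') ({Bp R} + R')) := by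
  simp only [I, dL, cutsF, Multiset.map_coe, Multiset.sum_coe, List.flatMap_cons, List.map_append,
    List.sum_append, List.map_map]
  congr 1
  · simp only [Function.comp_def, Pcut, Rcut, clF_cons, clT_node]
  · generalize cutsF l = cs
    induction cs with
    | nil => rfl
    | cons c cs ih =>
      simp only [List.map_cons, List.flatMap_cons, List.map_append, List.sum_append, ih,
        List.sum_cons, List.map_map]
      congr 1
      simp only [Function.comp_def, Pcut, Rcut, clF_cons, clT_node, clF_append]

lemma I_dL_single (l : List RTree) (φ) :
    I (dL [.node l]) φ = φ {Bp (clF l)} 0 + I (dL l) (fun P R => φ P {Bp R}) := by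
  rw [I_dL_cons]
  simp [I_dL_nil]

lemma I_dL_cons' (t : RTree) (ts : List RTree) (φ) :
    I (dL (t :: ts)) φ
      = I (dL [t]) (fun P R => I (dL ts) fun P' R' => φ (P + P') (R + R')) := by
  cases t with
  | node l => rw [I_dL_cons, I_dL_single]; simp

lemma I_dL_append (F G : List RTree) : ∀ φ, 
    I (dL (F ++ G)) φ
      = I (dL F) (fun P R => I (dL G) fun P' R' => φ (P + P') (R + R')) := by
  induction F with
  | nil => intro φ; simp [I_dL_nil]
  | cons t F ih =>
    intro φ
    rw [List.cons_append, I_dL_cons', I_dL_cons' t F]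
    simp only [ih, add_assoc]

lemma I_dL_perm {F G : List RTree} (h : F.Perm G) : ∀ φ, I (dL F) φ = I (dL G) φ := by
  induction h with
  | nil => intro φ; rfl
  | @cons t l l' _ ih => intro φ; rw [I_dL_cons' t l, I_dL_cons' t l']; simp only [ih]
  | swap s t l =>
    intro φ
    rw [I_dL_cons', I_dL_cons' s]
    simp only [I_dL_cons' s l, I_dL_cons' t l]
    rw [I_comm]
    simp only [add_left_comm]
  | trans _ _ h1 h2 => intro φ; rw [h1, h2]

lemma I_dL_forall {F G : List RTree}
    (h : List.Forall₂ (fun s t => ∀ φ, I (dL [s]) φ = I (dL [t]) φ) F G) :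
    ∀ φ, I (dL F) φ = I (dL G) φ := by
  induction h with
  | nil => intro φ; rfl
  | @cons a b F G hab _ ih => intro φ; rw [I_dL_cons', I_dL_cons' b, hab]; simp only [ih]

lemma forall₂_imp_mem {α β : Type*} {r q : α → β → Prop} {F : List α} {G : List β}
    (h : List.Forall₂ r F G) (hq : ∀ s ∈ F, ∀ t, r s t → q s t) : List.Forall₂ q F G := by
  induction h with
  | nil => exact .nil
  | @cons a b F G hab _ ih =>
    exact .cons (hq a (by simp) b hab) (ih fun s hs => hq s (by simp [hs]))

lemma clF_eq_of_forall {F G : List RTree} (h : List.Forall₂ Iso F G) : clF F = clF G := by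
  induction h with
  | nil => rfl
  | @cons a b F G hab _ ih =>
    rw [clF_cons, clF_cons, ih, show clT a = clT b from Quot.sound hab]

lemma clF_perm {F G : List RTree} (h : F.Perm G) : clF F = clF G :=
  Multiset.coe_eq_coe.2 (h.map clT)

lemma I_dL_iso (s : RTree) : ∀ t, Iso s t → ∀ φ, I (dL [s]) φ = I (dL [t]) φ := by
  induction s using rtree_size_induction with
  | h l ih =>
    intro t h φ
    cases h with
    | @node _ l' l2 h1 h2 =>
      rw [I_dL_single, I_dL_single, clF_eq_of_forall h1, clF_perm h2,
        I_dL_forall (forall₂_imp_mem h1 ih), I_dL_perm h2]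

lemma I_dL_clT {s t : RTree} (h : clT s = clT t) : ∀ φ, I (dL [s]) φ = I (dL [t]) φ := by
  have := congrArg (Quot.lift (fun a => I (dL [a]))
    (fun a b hab => funext fun φ => I_dL_iso a b hab φ)) h
  exact fun φ => congrFun this φ

lemma I_dL_clF {F G : List RTree} (h : clF F = clF G) : ∀ φ, I (dL F) φ = I (dL G) φ := by
  obtain ⟨G', h1, h2⟩ := exists_of_clF_eq h
  intro φ
  rw [I_dL_forall (forall₂_imp_mem h1 fun s _ t hst => I_dL_clT hst), I_dL_perm h2]

/-- The multiset of `(P,R)` over all cuts of a forest class. -/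
noncomputable def D (M : ForestClass) : Multiset (ForestClass × ForestClass) := dL (repF M)

lemma I_D_clF (F : List RTree) (φ) : I (D (clF F)) φ = I (dL F) φ :=
  I_dL_clF (clF_repF _) φ

lemma I_D_zero (φ) : I (D 0) φ = φ 0 0 := by
  rw [← clF_nil, I_D_clF, I_dL_nil]; rfl

lemma I_D_add (X Y : ForestClass) (φ) :
    I (D (X + Y)) φ = I (D X) (fun P R => I (D Y) fun P' R' => φ (P + P') (R + R')) := by
  have : X + Y = clF (repF X ++ repF Y) := by rw [clF_append, clF_repF, clF_repF]
  rw [this, I_D_clF, I_dL_append]; rfl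

lemma I_D_single (F : ForestClass) (φ) :
    I (D {Bp F}) φ = φ {Bp F} 0 + I (D F) (fun P R => φ P {Bp R}) := by
  have : ({Bp F} : ForestClass) = clF [.node (repF F)] := by
    rw [clF_cons, clF_nil]; rfl
  rw [this, I_D_clF, I_dL_single, clF_repF, ← this]; rfl

lemma forest_induction {p : ForestClass → Prop} (h0 : p 0)
    (h1 : ∀ F M, p F → p M → p ({Bp F} + M)) (M : ForestClass) : p M := by
  have key : ∀ F : List RTree, p (clF F) := by
    intro F
    induction F using sizeL.induct with
    | case1 => exact h0
    | case2 l ts ih1 ih2 => rw [clF_cons, clT_node]; exact h1 _ _ ih1 ih2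
  rw [← clF_repF M]; exact key _

lemma counitL (M : ForestClass) : ∀ g : ForestClass → ℚ,
    I (D M) (fun P R => if P = 0 then g R else 0) = g M := by
  induction M using forest_induction with
  | h0 => intro g; simp [I_D_zero]
  | h1 F M ihF ihM =>
    intro g
    rw [I_D_add, I_D_single]
    have e : ∀ P R : ForestClass, I (D M) (fun P' R' => if P + P' = 0 then g ({Bp R} + R') else 0)
        = if P = 0 then g ({Bp R} + M) else 0 := by
      intro P R
      by_cases hP : P = 0
      · simp only [hP, zero_add, if_true]; exact ihM fun R' => g ({Bp R} + R')
      · simp [hP, I_zero]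
    simp only [e]
    rw [ihF fun R => g ({Bp R} + M)]
    simp [I_zero]

lemma counitR (M : ForestClass) : ∀ g : ForestClass → ℚ,
    I (D M) (fun P R => if R = 0 then g P else 0) = g M := by
  induction M using forest_induction with
  | h0 => intro g; simp [I_D_zero]
  | h1 F M ihF ihM =>
    intro g
    rw [I_D_add, I_D_single]
    have e := ihM fun R' => g ({Bp F} + R')
    simp only [zero_add]
    rw [e]
    simp [I_zero]

lemma coassoc (M : ForestClass) : ∀ φ : ForestClass → ForestClass → ForestClass → ℚ,
    I (D M) (fun X C => I (D X) fun A B => φ A B C)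
      = I (D M) (fun A Y => I (D Y) fun B C => φ A B C) := by
  induction M using forest_induction with
  | h0 => intro g; simp [I_D_zero]
  | h1 F M ihF ihM =>
    intro φ
    have t : ∀ φ : ForestClass → ForestClass → ForestClass → ℚ,
        I (D {Bp F}) (fun X C => I (D X) fun A B => φ A B C)
          = I (D {Bp F}) (fun A Y => I (D Y) fun B C => φ A B C) := by
      intro φ
      rw [I_D_single, I_D_single, I_D_single, I_D_zero, ihF fun A B C => φ A B {Bp C}]
      simp only [I_D_single, I_add]
      ring
    rw [I_D_add, I_D_add]
    simp only [I_D_add]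
    have l1 : ∀ P R : ForestClass,
        I (D M) (fun P' R' => I (D P) fun A B => I (D P') fun A' B' =>
          φ (A + A') (B + B') (R + R'))
        = I (D P) (fun A B => I (D M) fun P' R' => I (D P') fun A' B' =>
          φ (A + A') (B + B') (R + R')) := fun P R => I_comm _ _ _
    have l2 : ∀ P R : ForestClass,
        I (D M) (fun P' R' => I (D R) fun A B => I (D R') fun A' B' =>
          φ (P + P') (A + A') (B + B'))
        = I (D R) (fun A B => I (D M) fun P' R' => I (D R') fun A' B' =>
          φ (P + P') (A + A') (B + B')) := fun P R => I_comm _ _ _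
    simp only [l1, l2]
    have l3 : ∀ A B C : ForestClass,
        I (D M) (fun P' R' => I (D P') fun A' B' => φ (A + A') (B + B') (C + R'))
        = I (D M) (fun P' R' => I (D R') fun A' B' => φ (A + P') (B + A') (C + B')) :=
      fun A B C => ihM fun A' B' C' => φ (A + A') (B + B') (C + C')
    simp only [l3]
    exact t fun A B C =>
      I (D M) (fun P' R' => I (D R') fun A' B' => φ (A + P') (B + A') (C + B'))

/-! ### Sizes and supports -/

lemma cut_supp (F : List RTree) : ∀ c ∈ cutsF F,
    (F.length ≤ (Pcut F c).length + (Rcut F c).length) ∧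
    (Pcut F c = [] → Rcut F c = F) ∧
    (F.length = (Pcut F c).length + (Rcut F c).length →
      clF F = clF (Pcut F c) + clF (Rcut F c)) ∧
    sizeL F = sizeL (Pcut F c) + sizeL (Rcut F c) := by
  have happ : ∀ F G, sizeL (F ++ G) = sizeL F + sizeL G := by
    intro F G
    induction F using sizeL.induct with
    | case1 => simp [sizeL]
    | case2 l ts ih1 ih2 => simp [sizeL, ih2]; omega
  induction F using sizeL.induct with
  | case1 => simp [cutsF, Pcut, Rcut, sizeL, clF_nil]
  | case2 l ts ih1 ih2 =>
    intro c hc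
    simp only [cutsF, List.mem_flatMap, List.mem_cons, List.mem_map] at hc
    obtain ⟨d, hd, cs, hcs, rfl⟩ := hc
    obtain ⟨a1, a2, a3, a4⟩ := ih2 cs hcs
    rcases hd with rfl | ⟨ds, hds, rfl⟩
    · simp only [Pcut, Rcut, List.length_cons, clF_cons, sizeL]
      refine ⟨by omega, by simp, fun h => ?_, by omega⟩
      rw [a3 (by omega), add_assoc]
    · obtain ⟨b1, b2, b3, b4⟩ := ih1 ds hds
      simp only [Pcut, Rcut, List.length_cons, List.length_append, clF_cons, sizeL, happ,
        clF_append]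
      refine ⟨by omega, ?_, fun h => ?_, by omega⟩
      · intro h
        rw [List.append_eq_nil_iff] at h
        rw [b2 h.1, a2 h.2]
      · have h0 : Pcut l ds = [] := List.length_eq_zero_iff.1 (by omega)
        rw [b2 h0, h0, clF_nil, a3 (by omega)]
        simp [add_left_comm]

lemma D_supp (M : ForestClass) : ∀ p ∈ D M, M.card ≤ p.1.card + p.2.card ∧
    (M.card = p.1.card + p.2.card → M = p.1 + p.2) := by
  intro p hp
  unfold D dL at hp
  rw [Multiset.mem_coe, List.mem_map] at hp
  obtain ⟨c, hc, rfl⟩ := hp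
  obtain ⟨h1, -, h3, -⟩ := cut_supp _ c hc
  have h4 := card_clF (repF M)
  rw [clF_repF] at h3 h4
  simp only [card_clF, h4]
  exact ⟨h1, h3⟩

lemma sizeL_perm {F G : List RTree} (h : F.Perm G) : sizeL F = sizeL G := by
  induction h with
  | nil => rfl
  | cons t _ ih => cases t; simp [sizeL, ih]
  | swap s t l => cases s; cases t; simp [sizeL]; omega
  | trans _ _ h1 h2 => rw [h1, h2]

lemma sizeL_cons (t : RTree) (ts) : sizeL (t :: ts) = sizeL [t] + sizeL ts := by
  cases t; simp [sizeL]

lemma sizeL_forall {F G : List RTree}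
    (h : List.Forall₂ (fun s t => sizeL [s] = sizeL [t]) F G) : sizeL F = sizeL G := by
  induction h with
  | nil => rfl
  | @cons a b F G hab _ ih => rw [sizeL_cons, sizeL_cons b, hab, ih]

lemma sizeL_iso (s : RTree) : ∀ t, Iso s t → sizeL [s] = sizeL [t] := by
  induction s using rtree_size_induction with
  | h l ih =>
    intro t h
    cases h with
    | @node _ l' l2 h1 h2 =>
      simp only [sizeL]
      rw [sizeL_forall (forall₂_imp_mem h1 ih), sizeL_perm h2]

lemma sizeL_clF {F G : List RTree} (h : clF F = clF G) : sizeL F = sizeL G := by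
  obtain ⟨G', h1, h2⟩ := exists_of_clF_eq h
  rw [← sizeL_perm h2]
  refine sizeL_forall (forall₂_imp_mem h1 fun s _ t hst => ?_)
  exact congrArg (Quot.lift (fun a => sizeL [a]) (fun a b hab => sizeL_iso a b hab)) hst

lemma sizeC_clF (F : List RTree) : sizeC (clF F) = sizeL F := sizeL_clF (clF_repF _)

lemma mem_forestsUpTo (n : ℕ) : ∀ F, sizeL F ≤ n → F ∈ forestsUpTo n := by
  induction n with
  | zero =>
    intro F h
    cases F with
    | nil => simp [forestsUpTo]
    | cons t ts => cases t; simp [sizeL] at h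
  | succ n ih =>
    intro F h
    cases F with
    | nil => simp [forestsUpTo]
    | cons t ts =>
      cases t with
      | node l =>
        simp only [sizeL] at h
        simp only [forestsUpTo, List.mem_cons, List.mem_flatMap, List.mem_map]
        exact Or.inr ⟨l, ih l (by omega), ts, ih ts (by omega), rfl⟩

lemma nCuts_eq (A B M : ForestClass) :
    (nCuts A B M : ℚ) = I (D M) (fun P R => if P = A ∧ R = B then 1 else 0) := by
  unfold nCuts I D dL
  rw [Multiset.map_coe, Multiset.sum_coe, List.map_map]
  generalize cutsF (repF M) = cs
  induction cs with
  | nil => simp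
  | cons c cs ih =>
    rw [List.countP_cons, List.map_cons, List.sum_cons, ← ih]
    simp only [decide_eq_true_eq, Function.comp]
    push_cast
    ring

lemma mulBasis_apply (A B M : ForestClass) : mulBasis A B M
    = I (D M) (fun P R => if P = A ∧ R = B then 1 else 0) := by
  rw [← nCuts_eq]
  unfold mulBasis delta
  rw [Finsupp.finsetSum_apply]
  simp only [Finsupp.smul_apply, smul_eq_mul, Finsupp.single_apply, mul_ite, mul_one, mul_zero]
  rw [Finset.sum_ite_eq']
  split_ifs with h
  · rfl
  · by_contra hne
    have hne' : nCuts A B M ≠ 0 := fun h0 => hne (by simp [h0])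
    unfold nCuts at hne'
    rw [← Nat.pos_iff_ne_zero, List.countP_pos_iff] at hne'
    obtain ⟨c, hc, hP⟩ := hne'
    simp only [decide_eq_true_eq] at hP
    apply h
    unfold forestCand
    rw [List.mem_toFinset, List.mem_map]
    refine ⟨repF M, mem_forestsUpTo _ _ ?_, clF_repF M⟩
    rw [← hP.1, ← hP.2, sizeC_clF, sizeC_clF]
    exact (cut_supp _ c hc).2.2.2.le

lemma hmul_apply (f g : H) (M : ForestClass) :
    hmul f g M = I (D M) (fun P R => f P * g R) := by
  have e : ∀ (f : H) (P : ForestClass), f P = ∑ A ∈ f.support, f A * (if P = A then 1 else 0) := by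
    intro f P
    simp
  have : (fun P R => f P * g R) = fun P R => ∑ A ∈ f.support, ∑ B ∈ g.support,
      (f A * g B) * (if P = A ∧ R = B then 1 else 0) := by
    funext P R
    conv_lhs => rw [e f P, e g R, Finset.sum_mul_sum]
    refine Finset.sum_congr rfl fun A _ => Finset.sum_congr rfl fun B _ => ?_
    by_cases h1 : P = A <;> by_cases h2 : R = B <;> simp [h1, h2]
  rw [this, I_sum]
  simp only [I_sum, I_mul_left, ← mulBasis_apply]
  simp only [hmul, Finsupp.sum, Finsupp.finsetSum_apply, Finsupp.smul_apply, smul_eq_mul]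

/-! ### The abstract argument -/

/-- The properties of a family of pairs (cuts) used below. -/
structure Good (E : ForestClass → Multiset (ForestClass × ForestClass)) : Prop where
  zero : ∀ φ, I (E 0) φ = φ 0 0
  add : ∀ X Y φ,
    I (E (X + Y)) φ = I (E X) (fun P R => I (E Y) fun P' R' => φ (P + P') (R + R'))
  counitL : ∀ M (g : ForestClass → ℚ), I (E M) (fun P R => if P = 0 then g R else 0) = g M
  counitR : ∀ M (g : ForestClass → ℚ), I (E M) (fun P R => if R = 0 then g P else 0) = g M
  coassoc : ∀ M (φ : ForestClass → ForestClass → ForestClass → ℚ),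
    I (E M) (fun X C => I (E X) fun A B => φ A B C)
      = I (E M) (fun A Y => I (E Y) fun B C => φ A B C)
  supp : ∀ M, ∀ p ∈ E M, M.card ≤ p.1.card + p.2.card ∧
    (M.card = p.1.card + p.2.card → M = p.1 + p.2)

lemma good_D : Good D := ⟨I_D_zero, I_D_add, counitL, counitR, coassoc, D_supp⟩

/-- Exchange of the two entries. -/
noncomputable def D' (M : ForestClass) : Multiset (ForestClass × ForestClass) :=
  (D M).map Prod.swap

lemma I_D' (M : ForestClass) (φ) : I (D' M) φ = I (D M) (fun P R => φ R P) := by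
  simp [I, D']

lemma good_D' : Good D' := by
  refine ⟨?_, ?_, ?_, ?_, ?_, ?_⟩
  · intro φ; simp only [I_D', I_D_zero]
  · intro X Y φ; simp only [I_D', I_D_add]
  · intro M g; simp only [I_D', counitR]
  · intro M g; simp only [I_D', counitL]
  · intro M φ; simp only [I_D']; exact (coassoc M fun A B C => φ C B A).symm
  · intro M p hp
    obtain ⟨q, hq, rfl⟩ := Multiset.mem_map.1 hp
    have := D_supp M q hq
    simp only [Prod.fst_swap, Prod.snd_swap]
    rw [add_comm q.2.card, add_comm q.2]
    exact this

lemma coprod_delta (M : ForestClass) : coprod (delta M) = deltaBasis M := by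
  simp [coprod, delta]

lemma delta_apply (A B : ForestClass) : delta A B = if B = A then 1 else 0 := by
  simp [delta, Finsupp.single_apply, eq_comm]

lemma coprod_apply (h : H) (X Y : ForestClass) : coprod h (X, Y) = h (X + Y) := by
  induction h using Finsupp.induction_linear with
  | zero => simp
  | add f g hf hg => simp [hf, hg]
  | single M b =>
    have : (Finsupp.single M b : H) = b • delta M := by simp [delta]
    rw [this, map_smul, coprod_delta, Finsupp.smul_apply, Finsupp.smul_apply, delta_apply]
    congr 1
    unfold deltaBasis
    rw [Finsupp.finsetSum_apply]
    simp only [Finsupp.single_apply, Prod.mk.injEq]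
    by_cases h : X + Y = M
    · rw [if_pos h, Finset.sum_eq_single X]
      · subst h; simp
      · intro b _ hb; simp [hb]
      · intro hX
        exfalso; apply hX
        rw [Multiset.mem_toFinset, Multiset.mem_powerset, ← h]
        exact Multiset.le_add_right _ _
    · rw [if_neg h]
      apply Finset.sum_eq_zero
      intro A hA
      rw [Multiset.mem_toFinset, Multiset.mem_powerset] at hA
      rw [if_neg]
      rintro ⟨rfl, rfl⟩
      exact h (add_tsub_cancel_of_le hA)

/-- Linear map on pairs induced by a function on pairs of classes. -/
noncomputable def lift2 {V : Type*} [AddCommGroup V] [Module ℚ V]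
    (b : ForestClass → ForestClass → V) : H2 →ₗ[ℚ] V :=
  Finsupp.lsum ℚ fun p => LinearMap.toSpanSingleton ℚ V (b p.1 p.2)

lemma lift2_single {V : Type*} [AddCommGroup V] [Module ℚ V]
    (b : ForestClass → ForestClass → V) (p : ForestClass × ForestClass) (c : ℚ) :
    lift2 b (Finsupp.single p c) = c • b p.1 p.2 := by
  simp [lift2]

lemma lift2_coprod {V : Type*} [AddCommGroup V] [Module ℚ V]
    (b : ForestClass → ForestClass → V) (M : ForestClass) :
    lift2 b (coprod (delta M)) = ∑ A ∈ M.powerset.toFinset, b A (M - A) := by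
  rw [coprod_delta, deltaBasis, map_sum]
  simp [lift2_single]

/-- `h ⊗ δ_B`. -/
noncomputable def tenL (B : ForestClass) : H →ₗ[ℚ] H2 :=
  Finsupp.lmapDomain ℚ ℚ fun A => (A, B)

/-- `δ_A ⊗ h`. -/
noncomputable def tenR (A : ForestClass) : H →ₗ[ℚ] H2 :=
  Finsupp.lmapDomain ℚ ℚ fun B => (A, B)

lemma tenL_apply (B : ForestClass) (h : H) (X Y) :
    tenL B h (X, Y) = if Y = B then h X else 0 := by
  induction h using Finsupp.induction_linear with
  | zero => simp
  | add f g hf hg => simp only [map_add, Finsupp.add_apply, hf, hg]; split_ifs <;> simp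
  | single M b =>
    simp only [tenL, Finsupp.lmapDomain_apply, Finsupp.mapDomain_single, Finsupp.single_apply,
      Prod.mk.injEq]
    by_cases h1 : M = X <;> by_cases h2 : B = Y <;> simp [h1, h2, eq_comm]

lemma tenR_apply (A : ForestClass) (h : H) (X Y) :
    tenR A h (X, Y) = if X = A then h Y else 0 := by
  induction h using Finsupp.induction_linear with
  | zero => simp
  | add f g hf hg => simp only [map_add, Finsupp.add_apply, hf, hg]; split_ifs <;> simp
  | single M b =>
    simp only [tenR, Finsupp.lmapDomain_apply, Finsupp.mapDomain_single, Finsupp.single_apply,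
      Prod.mk.injEq]
    by_cases h1 : M = Y <;> by_cases h2 : A = X <;> simp [h1, h2, eq_comm]

section abs

variable {E : ForestClass → Multiset (ForestClass × ForestClass)}
  {mul : H →ₗ[ℚ] H →ₗ[ℚ] H}

lemma abs_one_mul (hE : Good E)
    (hm : ∀ f g M, mul f g M = I (E M) (fun P R => f P * g R)) (v : H) :
    mul (delta 0) v = v := by
  ext M
  rw [hm, ← hE.counitL M v]
  simp [delta_apply]

lemma abs_mul_one (hE : Good E)
    (hm : ∀ f g M, mul f g M = I (E M) (fun P R => f P * g R)) (v : H) :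
    mul v (delta 0) = v := by
  ext M
  rw [hm, ← hE.counitR M v]
  simp [delta_apply]

lemma abs_assoc (hE : Good E)
    (hm : ∀ f g M, mul f g M = I (E M) (fun P R => f P * g R)) (u v w : H) :
    mul (mul u v) w = mul u (mul v w) := by
  ext M
  rw [hm, hm]
  simp only [hm, ← I_mul_left, ← I_mul_right, mul_assoc]
  exact hE.coassoc M fun A B C => u A * (v B * w C)

/-- `(δ_T ×) ⊗ id`. -/
noncomputable def PT (mul : H →ₗ[ℚ] H →ₗ[ℚ] H) (T : TreeClass) : H2 →ₗ[ℚ] H2 :=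
  lift2 fun A B => tenL B (mul (delta {T}) (delta A))

/-- `id ⊗ (δ_T ×)`. -/
noncomputable def QT (mul : H →ₗ[ℚ] H →ₗ[ℚ] H) (T : TreeClass) : H2 →ₗ[ℚ] H2 :=
  lift2 fun A B => tenR A (mul (delta {T}) (delta B))

lemma PT_apply (hm : ∀ f g M, mul f g M = I (E M) (fun P R => f P * g R)) (T : TreeClass)
    (w : H2) (X Y : ForestClass) :
    PT mul T w (X, Y) = I (E X) (fun P R => delta {T} P * w (R, Y)) := by
  induction w using Finsupp.induction_linear with
  | zero => simp [I_zero]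
  | add f g hf hg => simp only [map_add, Finsupp.add_apply, hf, hg, mul_add, I_add]
  | single p b =>
    obtain ⟨A, B⟩ := p
    rw [PT, lift2_single, Finsupp.smul_apply, tenL_apply, hm, smul_eq_mul]
    by_cases h : Y = B
    · rw [if_pos h, ← I_mul_left]
      congr 1
      funext P R
      subst h
      by_cases h' : R = A
      · simp [delta_apply, h']
      · simp [delta_apply, h']
    · simp [h, I_zero]

lemma QT_apply (hm : ∀ f g M, mul f g M = I (E M) (fun P R => f P * g R)) (T : TreeClass)
    (w : H2) (X Y : ForestClass) :
    QT mul T w (X, Y) = I (E Y) (fun P R => delta {T} P * w (X, R)) := by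
  induction w using Finsupp.induction_linear with
  | zero => simp [I_zero]
  | add f g hf hg => simp only [map_add, Finsupp.add_apply, hf, hg, mul_add, I_add]
  | single p b =>
    obtain ⟨A, B⟩ := p
    rw [QT, lift2_single, Finsupp.smul_apply, tenR_apply, hm, smul_eq_mul]
    by_cases h : X = A
    · rw [if_pos h, ← I_mul_left]
      congr 1
      funext P R
      subst h
      by_cases h' : R = B
      · simp [delta_apply, h']
      · simp [delta_apply, h']
    · simp [h, I_zero]

lemma delta_add_split (T : TreeClass) (P P' : ForestClass) :
    (delta {T} (P + P') : ℚ) = delta {T} P * (if P' = 0 then 1 else 0)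
      + (if P = 0 then 1 else 0) * delta {T} P' := by
  simp only [delta_apply]
  by_cases hP : P = 0
  · subst hP
    by_cases hP' : P' = 0
    · subst hP'; simp
    · simp [hP']
  · by_cases hP' : P' = 0
    · subst hP'; simp [hP]
    · have : P + P' ≠ {T} := by
        intro h
        have h1 := congrArg Multiset.card h
        have h2 := Multiset.card_pos.2 hP
        have h3 := Multiset.card_pos.2 hP'
        simp at h1
        omega
      simp [this, hP, hP']

lemma mul_tree_add (hE : Good E)
    (hm : ∀ f g M, mul f g M = I (E M) (fun P R => f P * g R)) (T : TreeClass) (v : H)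
    (X Y : ForestClass) :
    mul (delta {T}) v (X + Y) = I (E X) (fun P R => delta {T} P * v (R + Y))
      + I (E Y) (fun P R => delta {T} P * v (X + R)) := by
  rw [hm, hE.add]
  have e : ∀ P R : ForestClass,
      I (E Y) (fun P' R' => delta {T} (P + P') * v (R + R'))
        = delta {T} P * v (R + Y)
          + (if P = 0 then I (E Y) (fun P' R' => delta {T} P' * v (R + R')) else 0) := by
    intro P R
    have := hE.counitL Y fun R' => v (R + R')
    rw [← this, ← I_mul_left]
    by_cases hP : P = 0
    · rw [if_pos hP, ← I_add]
      congr 1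
      funext P' R'
      rw [delta_add_split]
      split_ifs <;> ring
    · rw [if_neg hP, add_zero]
      congr 1
      funext P' R'
      rw [delta_add_split]
      split_ifs <;> ring
  simp only [e]
  rw [I_add, hE.counitL X fun R => I (E Y) (fun P' R' => delta {T} P' * v (R + R'))]

lemma coprod_mul_tree (hE : Good E)
    (hm : ∀ f g M, mul f g M = I (E M) (fun P R => f P * g R)) (T : TreeClass) (v : H) :
    coprod (mul (delta {T}) v) = PT mul T (coprod v) + QT mul T (coprod v) := by
  ext ⟨X, Y⟩
  rw [coprod_apply, Finsupp.add_apply, PT_apply hm, QT_apply hm, mul_tree_add hE hm]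
  simp only [coprod_apply]

/-- The bilinear map `(x,y) ↦ f(x) × y` on pairs. -/
noncomputable def cv (mul : H →ₗ[ℚ] H →ₗ[ℚ] H) (f : H →ₗ[ℚ] H) : H2 →ₗ[ℚ] H :=
  lift2 fun A B => mul (f (delta A)) (delta B)

lemma single_eq (A : ForestClass) (c : ℚ) : (Finsupp.single A c : H) = c • delta A := by
  simp [delta]

lemma cv_tenL (f : H →ₗ[ℚ] H) (B : ForestClass) (h : H) :
    cv mul f (tenL B h) = mul (f h) (delta B) := by
  induction h using Finsupp.induction_linear with
  | zero => simp
  | add f g hf hg => simp [hf, hg]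
  | single M b =>
    simp only [tenL, Finsupp.lmapDomain_apply, Finsupp.mapDomain_single, cv, lift2_single]
    rw [single_eq]; simp

lemma cv_tenR (f : H →ₗ[ℚ] H) (A : ForestClass) (h : H) :
    cv mul f (tenR A h) = mul (f (delta A)) h := by
  induction h using Finsupp.induction_linear with
  | zero => simp
  | add f g hf hg => simp [hf, hg]
  | single M b =>
    simp only [tenR, Finsupp.lmapDomain_apply, Finsupp.mapDomain_single, cv, lift2_single]
    rw [single_eq]; simp

/-- The antipode on basis elements. -/
noncomputable def Sb (mul : H →ₗ[ℚ] H →ₗ[ℚ] H) (M : ForestClass) : H :=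
  if M = 0 then delta 0 else
    - ∑ A ∈ (M.powerset.toFinset.filter (· < M)).attach, mul (Sb mul A.1) (delta (M - A.1))
termination_by M.card
decreasing_by exact Multiset.card_lt_card (Finset.mem_filter.1 A.2).2

/-- The antipode. -/
noncomputable def Sa (mul : H →ₗ[ℚ] H →ₗ[ℚ] H) : H →ₗ[ℚ] H :=
  Finsupp.lsum ℚ fun M => LinearMap.toSpanSingleton ℚ H (Sb mul M)

lemma Sa_delta (M : ForestClass) : Sa mul (delta M) = Sb mul M := by
  simp [Sa, delta]

lemma Sa_zero : Sa mul (delta 0) = delta 0 := by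
  rw [Sa_delta, Sb, if_pos rfl]

lemma cv_coprod_delta (hE : Good E)
    (hm : ∀ f g M, mul f g M = I (E M) (fun P R => f P * g R))
    (f : H →ₗ[ℚ] H) (M : ForestClass) :
    cv mul f (coprod (delta M)) = f (delta M)
      + ∑ A ∈ M.powerset.toFinset.filter (· < M), mul (f (delta A)) (delta (M - A)) := by
  rw [cv, lift2_coprod, ← Finset.sum_filter_add_sum_filter_not _ (· < M), add_comm]
  congr 1
  rw [Finset.sum_eq_single M]
  · rw [tsub_self, abs_mul_one hE hm]
  · intro A hA hne
    rw [Finset.mem_filter, Multiset.mem_toFinset, Multiset.mem_powerset] at hA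
    exact absurd (lt_of_le_of_ne hA.1 hne) hA.2
  · intro h
    exfalso; apply h
    simp

lemma cv_Sa (hE : Good E)
    (hm : ∀ f g M, mul f g M = I (E M) (fun P R => f P * g R)) (h : H) :
    cv mul (Sa mul) (coprod h) = h 0 • delta 0 := by
  induction h using Finsupp.induction_linear with
  | zero => simp
  | add f g hf hg => simp [hf, hg, add_smul]
  | single M b =>
    rw [single_eq, map_smul, map_smul, cv_coprod_delta hE hm, Finsupp.smul_apply, smul_assoc]
    congr 1
    rw [delta_apply]
    simp only [Sa_delta]
    by_cases hM : M = 0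
    · subst hM
      have : (Multiset.powerset (0 : ForestClass)).toFinset.filter (· < 0) = ∅ := by
        apply Finset.filter_false_of_mem
        intro A _
        exact not_lt_bot
      rw [this, Sb]; simp
    · rw [Sb, if_neg hM, if_neg (Ne.symm hM),
        Finset.sum_attach _ (fun A => mul (Sb mul A) (delta (M - A)))]
      simp

lemma eq_zero_of_cv (hE : Good E)
    (hm : ∀ f g M, mul f g M = I (E M) (fun P R => f P * g R))
    (f : H →ₗ[ℚ] H) (h : ∀ v, cv mul f (coprod v) = 0) : f = 0 := by
  have key : ∀ M, f (delta M) = 0 := by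
    intro M
    induction M using WellFoundedLT.induction with
    | ind M ih =>
      have := h (delta M)
      rw [cv_coprod_delta hE hm, Finset.sum_eq_zero, add_zero] at this
      · exact this
      · intro A hA
        rw [ih A (Finset.mem_filter.1 hA).2]
        simp
  ext1 M
  ext1
  simpa [delta] using key M

lemma mul_tree_zero (hE : Good E)
    (hm : ∀ f g M, mul f g M = I (E M) (fun P R => f P * g R)) (T : TreeClass) (v : H) :
    mul (delta {T}) v 0 = 0 := by
  rw [hm, hE.zero, delta_apply, if_neg, zero_mul]
  exact (Multiset.singleton_ne_zero T).symm

lemma Sa_mul_tree (hE : Good E)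
    (hm : ∀ f g M, mul f g M = I (E M) (fun P R => f P * g R)) (T : TreeClass) (v : H) :
    Sa mul (mul (delta {T}) v) = - mul (Sa mul v) (delta {T}) := by
  have e1 : ∀ w, cv mul (Sa mul ∘ₗ mul (delta {T})) w = cv mul (Sa mul) (PT mul T w) := by
    intro w
    induction w using Finsupp.induction_linear with
    | zero => simp
    | add f g hf hg => simp only [map_add, hf, hg]
    | single p b => rw [PT, lift2_single, map_smul, cv_tenL, cv, lift2_single]; rfl
  have e2 : ∀ w, cv mul (mul.flip (delta {T}) ∘ₗ Sa mul) w = cv mul (Sa mul) (QT mul T w) := by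
    intro w
    induction w using Finsupp.induction_linear with
    | zero => simp
    | add f g hf hg => simp only [map_add, hf, hg]
    | single p b =>
      rw [QT, lift2_single, map_smul, cv_tenR, cv, lift2_single, ← abs_assoc hE hm]; rfl
  have e3 : ∀ f g w, cv mul (f + g) w = cv mul f w + cv mul g w := by
    intro f g w
    induction w using Finsupp.induction_linear with
    | zero => simp
    | add x y hx hy => simp only [map_add, hx, hy]; abel
    | single p b => simp [cv, lift2_single]
  have h0 : Sa mul ∘ₗ mul (delta {T}) + mul.flip (delta {T}) ∘ₗ Sa mul = 0 := by
    apply eq_zero_of_cv hE hm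
    intro v
    rw [e3, e1, e2, ← map_add, ← coprod_mul_tree hE hm, cv_Sa hE hm, mul_tree_zero hE hm, zero_smul]
  have := LinearMap.congr_fun h0 v
  exact eq_neg_of_add_eq_zero_left this

lemma generation (hE : Good E)
    (hm : ∀ f g M, mul f g M = I (E M) (fun P R => f P * g R)) (θ : H →ₗ[ℚ] H)
    (h0 : θ (delta 0) = delta 0)
    (hT : ∀ (T : TreeClass) v, θ (mul (delta {T}) v) = mul (delta {T}) (θ v)) (v : H) :
    θ v = v := by
  have key : ∀ n, ∀ M : ForestClass, M.card ≤ n → θ (delta M) = delta M := by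
    intro n
    induction n with
    | zero =>
      intro M hM
      have : M = 0 := Multiset.card_eq_zero.1 (by omega)
      rw [this, h0]
    | succ n ih =>
      intro M hM
      by_cases hM0 : M = 0
      · rw [hM0, h0]
      obtain ⟨T, hTM⟩ := Multiset.exists_mem_of_ne_zero hM0
      obtain ⟨M', rfl⟩ := Multiset.exists_cons_of_mem hTM
      rw [Multiset.card_cons] at hM
      rw [← Multiset.singleton_add]
      set h : H := mul (delta {T}) (delta M') with hh
      have hsupp : ∀ Z, h Z ≠ 0 → Z.card ≤ n ∨ Z = {T} + M' := by
        intro Z hZ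
        rw [hh, hm] at hZ
        have : ∃ p ∈ E Z, p = ({T}, M') := by
          by_contra hne
          apply hZ
          unfold I
          apply Multiset.sum_eq_zero
          intro x hx
          obtain ⟨p, hp, rfl⟩ := Multiset.mem_map.1 hx
          simp only [delta_apply]
          by_cases h1 : p.1 = {T}
          · by_cases h2 : p.2 = M'
            · exact absurd ⟨p, hp, Prod.ext h1 h2⟩ hne
            · simp [h2]
          · simp [h1]
        obtain ⟨p, hp, rfl⟩ := this
        obtain ⟨s1, s2⟩ := hE.supp Z _ hp
        simp only [Multiset.card_singleton] at s1 s2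
        by_cases hc : Z.card = 1 + M'.card
        · exact Or.inr (s2 hc)
        · left; omega
      have hpos : h ({T} + M') ≠ 0 := by
        rw [hh, mul_tree_add hE hm]
        have a1 : I (E {T}) (fun P R => delta {T} P * delta M' (R + M')) = 1 := by
          have := hE.counitR {T} (delta {T})
          rw [delta_apply, if_pos rfl] at this
          rw [← this]
          congr 1
          funext P R
          by_cases hR : R = 0 <;> simp [delta_apply, hR]
        have a2 : 0 ≤ I (E M') (fun P R => delta {T} P * delta M' ({T} + R)) := by
          unfold I
          apply Multiset.sum_nonneg
          intro x hx
          obtain ⟨p, hp, rfl⟩ := Multiset.mem_map.1 hx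
          simp only [delta_apply]
          split_ifs <;> simp
        rw [a1]
        positivity
      have hθ : θ h - h = 0 := by
        rw [hh, hT, ih M' (by omega), sub_self]
      have hsum : θ h - h = ∑ Z ∈ h.support, h Z • (θ (delta Z) - delta Z) := by
        have hs : h = ∑ Z ∈ h.support, h Z • delta Z := by
          conv_lhs => rw [← Finsupp.sum_single h]
          simp only [Finsupp.sum, single_eq]
        conv_lhs => rw [hs]
        rw [map_sum, ← Finset.sum_sub_distrib]
        simp only [map_smul, smul_sub]
      rw [hsum, Finset.sum_eq_single ({T} + M')] at hθ
      · rw [smul_eq_zero] at hθ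
        exact sub_eq_zero.1 (hθ.resolve_left hpos)
      · intro Z hZ hne
        rcases hsupp Z (Finsupp.mem_support_iff.1 hZ) with hc | hc
        · rw [ih Z hc, sub_self, smul_zero]
        · exact absurd hc hne
      · intro hn
        exact absurd (Finsupp.mem_support_iff.2 hpos) hn
  have : θ = LinearMap.id := by
    ext1 M
    ext1
    simpa [delta] using key _ M le_rfl
  rw [this]; rfl

end abs

/-- The Hall product as a bilinear map. -/
noncomputable def mulH : H →ₗ[ℚ] H →ₗ[ℚ] H :=
  LinearMap.mk₂ ℚ hmul
    (fun a b c => by ext M; simp only [Finsupp.add_apply, hmul_apply, ← I_add, add_mul])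
    (fun r a b => by
      ext M
      simp only [Finsupp.smul_apply, hmul_apply, smul_eq_mul, ← I_mul_left, mul_assoc])
    (fun a b c => by ext M; simp only [Finsupp.add_apply, hmul_apply, ← I_add, mul_add])
    (fun r a b => by
      ext M
      simp only [Finsupp.smul_apply, hmul_apply, smul_eq_mul, ← I_mul_left, mul_left_comm])

lemma mulH_apply (f g : H) (M : ForestClass) :
    mulH f g M = I (D M) (fun P R => f P * g R) := hmul_apply f g M

lemma mulH_flip_apply (f g : H) (M : ForestClass) :
    mulH.flip f g M = I (D' M) (fun P R => f P * g R) := by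
  rw [I_D', LinearMap.flip_apply, mulH_apply]
  simp only [mul_comm]

/-- STATEMENT 12: there exists a linear automorphism `Φ` of `H` with
`Φ(δ_∅) = δ_∅` and `Φ(δ_T × v) = −Φ(v) × δ_T` for every rooted tree `T` and
every `v ∈ H`.  In particular the insertion representation of `n_T` on `H`
(`T` acting by `v ↦ δ_T × v`) is isomorphic to the top-insertion
representation (`T` acting by `v ↦ −v × δ_T`). -/
theorem insertion_iso_top_insertion :
    ∃ Φ : H ≃ₗ[ℚ] H,
      Φ (delta 0) = delta 0 ∧
      ∀ (T : TreeClass) (v : H),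
        Φ (hmul (delta ({T} : Multiset TreeClass)) v)
          = - hmul (Φ v) (delta ({T} : Multiset TreeClass)) := by
  have h1 := Sa_mul_tree good_D mulH_apply
  have h2 := Sa_mul_tree good_D' mulH_flip_apply
  simp only [LinearMap.flip_apply] at h2
  have h3 := generation good_D mulH_apply (Sa mulH.flip ∘ₗ Sa mulH)
    (by simp only [LinearMap.comp_apply, Sa_zero])
    (by intro T v; simp only [LinearMap.comp_apply, h1, map_neg, h2, neg_neg])
  have h4 := generation good_D' mulH_flip_apply (Sa mulH ∘ₗ Sa mulH.flip)
    (by simp only [LinearMap.comp_apply, Sa_zero])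
    (by intro T v; simp only [LinearMap.comp_apply, LinearMap.flip_apply, h2, map_neg, h1, neg_neg])
  refine ⟨LinearEquiv.ofLinearMap (Sa mulH) (Sa mulH.flip) (LinearMap.ext h4) (LinearMap.ext h3),
    Sa_zero, fun T v => h1 T v⟩

end CK
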